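/- If f is a multiplier of the space F_1 of Cauchy–Stieltjes integrals, then for every ζ on the unit circle, ∫_0^1 |f'(rζ)| dr ≤ (π/2) · ‖f‖_{m_1} < ∞. -/

import Mathlib

open MeasureTheory Metric Set Complex

noncomputable section

/-- A complex Borel measure on the unit circle, given by its polar decomposition:
a finite nonnegative measure (the total variation) together with a unimodular density. -/
structure CircleMeasure where
  ν : Measure (Metric.sphere (0:ℂ) 1)
  finite : IsFiniteMeasure ν
  w : Metric.sphere (0:ℂ) 1 → ℂ
  w_meas : Measurable w
  w_norm : ∀ ζ, ‖w ζ‖ = 1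

/-- Integral of a function against a complex measure. -/
def CircleMeasure.integral (μ : CircleMeasure) (f : Metric.sphere (0:ℂ) 1 → ℂ) : ℂ :=
  ∫ ζ, f ζ * μ.w ζ ∂μ.ν

/-- Total variation norm of a complex measure. -/
def CircleMeasure.norm (μ : CircleMeasure) : ℝ := (μ.ν Set.univ).toReal

/-- `μ` represents `g` in `F₁`: `g z = ∫_T (1 - conj ζ · z)⁻¹ dμ(ζ)` on the disk. -/
def RepF1 (g : ℂ → ℂ) (μ : CircleMeasure) : Prop :=
  ∀ z ∈ ball (0:ℂ) 1,
    g z = μ.integral (fun ζ => (1 - (starRingEnd ℂ) (ζ:ℂ) * z)⁻¹)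

/-- Membership in the space `F₁`. -/
def MemF1 (g : ℂ → ℂ) : Prop :=
  DifferentiableOn ℂ g (ball 0 1) ∧ ∃ μ : CircleMeasure, RepF1 g μ

/-- The `F₁` norm. -/
def normF1 (g : ℂ → ℂ) : ℝ := sInf {c | ∃ μ : CircleMeasure, RepF1 g μ ∧ μ.norm = c}

/-- `f` is a multiplier of `F₁`. -/
def MemM1 (f : ℂ → ℂ) : Prop :=
  DifferentiableOn ℂ f (ball 0 1) ∧ ∀ g, MemF1 g → MemF1 (fun z => f z * g z)

/-- The multiplier norm on `m₁`. -/
def normM1 (f : ℂ → ℂ) : ℝ :=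
  sSup {c | ∃ g, MemF1 g ∧ normF1 g ≤ 1 ∧ normF1 (fun z => f z * g z) = c}

open Filter Topology
open scoped ENNReal NNReal

instance (μ : CircleMeasure) : IsFiniteMeasure μ.ν := μ.finite

lemma exists_ofDensity (ν : Measure (Metric.sphere (0:ℂ) 1))
    (h : Metric.sphere (0:ℂ) 1 → ℂ) (hm : Measurable h) (hfin : ∫⁻ x, ‖h x‖ₑ ∂ν < ⊤) :
    ∃ μ : CircleMeasure, μ.norm = (∫⁻ x, ‖h x‖ₑ ∂ν).toReal ∧
      ∀ F : Metric.sphere (0:ℂ) 1 → ℂ, μ.integral F = ∫ x, F x * h x ∂ν := by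
  classical
  have hf : IsFiniteMeasure (ν.withDensity (fun x => ((‖h x‖₊ : ℝ≥0) : ℝ≥0∞))) := by
    apply isFiniteMeasure_withDensity
    exact hfin.ne
  refine ⟨⟨ν.withDensity (fun x => ((‖h x‖₊ : ℝ≥0) : ℝ≥0∞)), hf,
    fun x => if h x = 0 then 1 else h x / ‖h x‖, ?_, ?_⟩, ?_, ?_⟩
  · refine Measurable.ite (hm (measurableSet_singleton 0)) measurable_const ?_
    fun_prop
  · intro x
    by_cases hx : h x = 0
    · simp [hx]
    · simp [hx]
  · simp [CircleMeasure.norm, enorm_eq_nnnorm]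
  · intro F
    simp only [CircleMeasure.integral]
    rw [integral_withDensity_eq_integral_smul hm.nnnorm]
    congr 1
    ext x
    by_cases hx : h x = 0
    · simp [hx]
    · have : (‖h x‖ : ℂ) ≠ 0 := by simpa using hx
      simp only [hx, if_false, NNReal.smul_def, coe_nnnorm, Complex.real_smul]
      field_simp

lemma exists_sum {ι : Type} [Countable ι] (μ : ι → CircleMeasure)
    (hs : Summable fun n => (μ n).norm) :
    ∃ σ : CircleMeasure, σ.norm ≤ ∑' n, (μ n).norm ∧
      ∀ F : Metric.sphere (0:ℂ) 1 → ℂ, Measurable F → (∃ C, ∀ x, ‖F x‖ ≤ C) →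
        HasSum (fun n => (μ n).integral F) (σ.integral F) := by
  set ν : Measure (Metric.sphere (0:ℂ) 1) := Measure.sum fun n => (μ n).ν with hν
  have hnorm : ∀ n, (μ n).ν univ = ENNReal.ofReal (μ n).norm := fun n => by
    simp [CircleMeasure.norm]
  have hn0 : ∀ n, 0 ≤ (μ n).norm := fun n => ENNReal.toReal_nonneg
  have htot : ∑' n, (μ n).ν univ = ENNReal.ofReal (∑' n, (μ n).norm) := by
    rw [ENNReal.ofReal_tsum_of_nonneg hn0 hs]
    simp_rw [hnorm]
  have hfin : IsFiniteMeasure ν := ⟨by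
    rw [hν, Measure.sum_apply _ MeasurableSet.univ, htot]
    exact ENNReal.ofReal_lt_top⟩
  have hac : ∀ n, (μ n).ν ≪ ν := fun n => (Measure.le_sum _ n).absolutelyContinuous
  set h : ι → Metric.sphere (0:ℂ) 1 → ℂ :=
    fun n x => (((μ n).ν.rnDeriv ν x).toReal : ℂ) * (μ n).w x with hh
  have hhm : ∀ n, Measurable (h n) := fun n => by
    have := (μ n).w_meas
    have h2 := Measure.measurable_rnDeriv (μ n).ν ν
    simp only [hh]
    fun_prop
  have hhe : ∀ n, ∫⁻ x, ‖h n x‖ₑ ∂ν = ENNReal.ofReal (μ n).norm := fun n => by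
    rw [← hnorm, ← Measure.lintegral_rnDeriv (hac n)]
    apply lintegral_congr_ae
    filter_upwards [Measure.rnDeriv_lt_top (μ n).ν ν] with x hx
    rw [hh, ← ofReal_norm]
    simp only [norm_mul, (μ n).w_norm, mul_one]
    simp [ENNReal.ofReal_toReal hx.ne]
  have hle : ∫⁻ x, ‖∑' n, h n x‖ₑ ∂ν ≤ ENNReal.ofReal (∑' n, (μ n).norm) := by
    calc _ ≤ ∫⁻ x, ∑' n, ‖h n x‖ₑ ∂ν := lintegral_mono fun x => enorm_tsum_le_tsum_enorm
      _ = ∑' n, ∫⁻ x, ‖h n x‖ₑ ∂ν := lintegral_tsum fun n => (hhm n).enorm.aemeasurable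
      _ = _ := by simp_rw [hhe]; rw [ENNReal.ofReal_tsum_of_nonneg hn0 hs]
  obtain ⟨σ, hσ, hσF⟩ := exists_ofDensity ν (fun x => ∑' n, h n x) (Measurable.tsum hhm)
    (hle.trans_lt ENNReal.ofReal_lt_top)
  refine ⟨σ, ?_, ?_⟩
  · rw [hσ]
    exact ENNReal.toReal_le_of_le_ofReal (tsum_nonneg hn0) hle
  · rintro F hF ⟨C, hC⟩
    have hint : ∀ n, Integrable (h n) ν := fun n =>
      ⟨(hhm n).aestronglyMeasurable, by
        rw [HasFiniteIntegral, hhe]; exact ENNReal.ofReal_lt_top⟩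
    have hI : ∀ n, (μ n).integral F = ∫ x, F x * h n x ∂ν := fun n => by
      rw [CircleMeasure.integral, ← integral_rnDeriv_smul (hac n)]
      congr 1; ext x
      simp only [hh, Complex.real_smul]; ring
    rw [hσF]
    simp_rw [hI, ← tsum_mul_left]
    have hintF : ∀ n, Integrable (fun x => F x * h n x) ν := fun n =>
      (hint n).bdd_mul (c := C) hF.aestronglyMeasurable (Eventually.of_forall hC)
    apply hasSum_integral_of_summable_integral_norm hintF
    refine Summable.of_nonneg_of_le (fun n => by positivity) (fun n => ?_) (hs.mul_left C)
    have e : ∫ x, ‖h n x‖ ∂ν = (μ n).norm := by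
      rw [integral_norm_eq_lintegral_enorm (hhm n).aestronglyMeasurable, hhe,
        ENNReal.toReal_ofReal (hn0 n)]
    rw [← e, ← integral_const_mul]
    refine integral_mono (hintF n).norm ((hint n).norm.const_mul C) fun x => ?_
    simp only [norm_mul]
    gcongr
    exact hC x

lemma kernel_meas (z : ℂ) : Measurable fun ζ : Metric.sphere (0:ℂ) 1 =>
    (1 - (starRingEnd ℂ) (ζ:ℂ) * z)⁻¹ := by
  have : Measurable (starRingEnd ℂ) := Complex.continuous_conj.measurable
  fun_prop

lemma kernel_low (z : ℂ) (ζ : Metric.sphere (0:ℂ) 1) :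
    1 - ‖z‖ ≤ ‖1 - (starRingEnd ℂ) (ζ:ℂ) * z‖ := by
  have h1 : ‖(ζ:ℂ)‖ = 1 := by simpa using ζ.2
  have := norm_sub_norm_le (1:ℂ) ((starRingEnd ℂ) (ζ:ℂ) * z)
  simpa [h1] using this

lemma kernel_bdd (z : ℂ) (hz : z ∈ ball (0:ℂ) 1) (ζ : Metric.sphere (0:ℂ) 1) :
    ‖(1 - (starRingEnd ℂ) (ζ:ℂ) * z)⁻¹‖ ≤ (1 - ‖z‖)⁻¹ := by
  rw [norm_inv]
  have : ‖z‖ < 1 := by simpa using hz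
  exact inv_anti₀ (by linarith) (kernel_low z ζ)

lemma RepF1.sum {ι : Type} [Countable ι] (g : ι → ℂ → ℂ) (μ : ι → CircleMeasure)
    (hg : ∀ n, RepF1 (g n) (μ n)) (hs : Summable fun n => (μ n).norm) :
    ∃ σ : CircleMeasure, σ.norm ≤ ∑' n, (μ n).norm ∧ ∃ G : ℂ → ℂ, RepF1 G σ ∧
      (∀ z ∈ ball (0:ℂ) 1, HasSum (fun n => g n z) (G z)) := by
  obtain ⟨σ, h1, h2⟩ := exists_sum μ hs
  refine ⟨σ, h1, fun z => σ.integral (fun ζ => (1 - (starRingEnd ℂ) (ζ:ℂ) * z)⁻¹),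
    fun z _ => rfl, fun z hz => ?_⟩
  have := h2 _ (kernel_meas z) ⟨_, kernel_bdd z hz⟩
  simpa only [hg _ z hz] using this

lemma RepF1.congr {g g' : ℂ → ℂ} {μ : CircleMeasure} (h : RepF1 g μ)
    (he : ∀ z ∈ ball (0:ℂ) 1, g' z = g z) : RepF1 g' μ := fun z hz => by
  rw [he z hz, h z hz]

lemma RepF1.add {g g' : ℂ → ℂ} {μ μ' : CircleMeasure} (h : RepF1 g μ) (h' : RepF1 g' μ') :
    ∃ σ : CircleMeasure, σ.norm ≤ μ.norm + μ'.norm ∧ RepF1 (fun z => g z + g' z) σ := by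
  obtain ⟨σ, h1, G, hG, hs⟩ := RepF1.sum (fun b : Bool => if b then g else g')
    (fun b => if b then μ else μ') (by rintro (_ | _) <;> simpa) (Summable.of_finite)
  refine ⟨σ, by simpa using h1, hG.congr fun z hz => ?_⟩
  have := (hs z hz).unique (hasSum_fintype _)
  simpa using this.symm

lemma RepF1.smul {g : ℂ → ℂ} {μ : CircleMeasure} (h : RepF1 g μ) (c : ℂ) :
    ∃ σ : CircleMeasure, σ.norm = ‖c‖ * μ.norm ∧ RepF1 (fun z => c * g z) σ := by
  have hl : ∫⁻ x, ‖c * μ.w x‖ₑ ∂μ.ν = ‖c‖ₑ * μ.ν univ := by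
    have he : ∀ x, ‖c * μ.w x‖ₑ = ‖c‖ₑ := fun x => by
      rw [enorm_mul, ← ofReal_norm (μ.w x), μ.w_norm]; simp
    simp_rw [he]; simp
  obtain ⟨σ, h1, h2⟩ := exists_ofDensity μ.ν (fun x => c * μ.w x) (by
    have := μ.w_meas
    fun_prop) (by rw [hl]; exact ENNReal.mul_lt_top enorm_lt_top (measure_lt_top _ _))
  refine ⟨σ, ?_, fun z hz => ?_⟩
  · rw [h1, hl]; simp [CircleMeasure.norm]
  · show c * g z = _
    rw [h2, h z hz, CircleMeasure.integral, ← integral_const_mul]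
    congr 1; ext x; ring

lemma CircleMeasure.norm_nonneg (μ : CircleMeasure) : 0 ≤ μ.norm := ENNReal.toReal_nonneg

lemma normF1_le {g : ℂ → ℂ} {μ : CircleMeasure} (h : RepF1 g μ) : normF1 g ≤ μ.norm :=
  csInf_le ⟨0, by rintro _ ⟨μ, _, rfl⟩; exact μ.norm_nonneg⟩ ⟨μ, h, rfl⟩

lemma normF1_nonneg (g : ℂ → ℂ) : 0 ≤ normF1 g :=
  Real.sInf_nonneg (by rintro _ ⟨μ, _, rfl⟩; exact μ.norm_nonneg)

lemma exists_near {g : ℂ → ℂ} (h : ∃ μ, RepF1 g μ) {ε : ℝ} (hε : 0 < ε) :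
    ∃ μ, RepF1 g μ ∧ μ.norm < normF1 g + ε := by
  obtain ⟨μ, hμ⟩ := h
  obtain ⟨_, ⟨μ, h, rfl⟩, h2⟩ := exists_lt_of_csInf_lt
    (s := {c | ∃ μ : CircleMeasure, RepF1 g μ ∧ μ.norm = c}) ⟨_, μ, hμ, rfl⟩
    (lt_add_of_pos_right (normF1 g) hε)
  exact ⟨μ, h, h2⟩

lemma normF1_congr {g g' : ℂ → ℂ} (h : ∀ z ∈ ball (0:ℂ) 1, g z = g' z) :
    normF1 g = normF1 g' := by
  unfold normF1
  congr 1; ext c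
  exact ⟨fun ⟨μ, h1, h2⟩ => ⟨μ, h1.congr fun z hz => (h z hz).symm, h2⟩,
    fun ⟨μ, h1, h2⟩ => ⟨μ, h1.congr h, h2⟩⟩

lemma RepF1.bound {g : ℂ → ℂ} {μ : CircleMeasure} (h : RepF1 g μ) {z : ℂ}
    (hz : z ∈ ball (0:ℂ) 1) : ‖g z‖ ≤ (1 - ‖z‖)⁻¹ * μ.norm := by
  rw [h z hz, CircleMeasure.integral]
  refine (norm_integral_le_of_norm_le_const (C := (1 - ‖z‖)⁻¹)
    (Eventually.of_forall fun x => ?_)).trans le_rfl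
  rw [norm_mul, μ.w_norm, mul_one]
  exact kernel_bdd z hz x

lemma norm_le_normF1 {g : ℂ → ℂ} (h : ∃ μ, RepF1 g μ) {z : ℂ}
    (hz : z ∈ ball (0:ℂ) 1) : ‖g z‖ ≤ (1 - ‖z‖)⁻¹ * normF1 g := by
  have hz' : ‖z‖ < 1 := by simpa using hz
  have hp : 0 < 1 - ‖z‖ := by linarith
  apply le_of_forall_pos_le_add
  intro ε hε
  obtain ⟨μ, h1, h2⟩ := exists_near h (ε := (1 - ‖z‖) * ε) (by positivity)
  calc _ ≤ _ := h1.bound hz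
    _ ≤ (1 - ‖z‖)⁻¹ * (normF1 g + (1 - ‖z‖) * ε) := by gcongr
    _ = _ := by field_simp

/-- functions vanishing off the disk that are represented by a measure -/
def F1Sub : Submodule ℂ (ℂ → ℂ) where
  carrier := {g | (∃ μ, RepF1 g μ) ∧ ∀ z ∉ ball (0:ℂ) 1, g z = 0}
  add_mem' := by
    rintro a b ⟨⟨μ, h1⟩, h2⟩ ⟨⟨μ', h1'⟩, h2'⟩
    obtain ⟨σ, _, h⟩ := h1.add h1'
    exact ⟨⟨σ, h⟩, fun z hz => by simp [h2 z hz, h2' z hz]⟩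
  zero_mem' := by
    refine ⟨⟨⟨0, inferInstance, fun _ => 1, measurable_const, by simp⟩, fun z hz => ?_⟩, by simp⟩
    simp [CircleMeasure.integral]
  smul_mem' := by
    rintro c a ⟨⟨μ, h1⟩, h2⟩
    obtain ⟨σ, _, h⟩ := h1.smul c
    exact ⟨⟨σ, h⟩, fun z hz => by simp [h2 z hz]⟩

/-- The space as a type of its own. -/
def F1Space : Type := F1Sub

instance : AddCommGroup F1Space := inferInstanceAs (AddCommGroup F1Sub)
instance : Module ℂ F1Space := inferInstanceAs (Module ℂ F1Sub)

/-- underlying function -/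
def F1Space.fn (g : F1Space) : ℂ → ℂ := Subtype.val g

lemma F1Space.ext' {a b : F1Space} (h : ∀ z ∈ ball (0:ℂ) 1, a.fn z = b.fn z) : a = b := by
  apply Subtype.ext
  funext z
  by_cases hz : z ∈ ball (0:ℂ) 1
  · exact h z hz
  · exact (a.2.2 z hz).trans (b.2.2 z hz).symm

lemma F1Space.fn_add (a b : F1Space) (z : ℂ) : (a + b).fn z = a.fn z + b.fn z := rfl
lemma F1Space.fn_sub (a b : F1Space) (z : ℂ) : (a - b).fn z = a.fn z - b.fn z := rfl
lemma F1Space.fn_zero (z : ℂ) : (0 : F1Space).fn z = 0 := rfl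
lemma F1Space.fn_smul (c : ℂ) (a : F1Space) (z : ℂ) : (c • a).fn z = c * a.fn z := rfl
lemma F1Space.rep (a : F1Space) : ∃ μ, RepF1 a.fn μ := a.2.1

/-- truncation -/
def F1Space.mk' (g : ℂ → ℂ) (h : ∃ μ, RepF1 g μ) : F1Space :=
  ⟨(ball (0:ℂ) 1).indicator g, by
    obtain ⟨μ, h⟩ := h
    exact ⟨⟨μ, h.congr fun z hz => by simp only [indicator_of_mem hz]⟩,
      fun z hz => by simp only [indicator_of_notMem hz]⟩⟩

lemma F1Space.fn_mk' (g : ℂ → ℂ) (h : ∃ μ, RepF1 g μ) {z : ℂ} (hz : z ∈ ball (0:ℂ) 1) :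
    (F1Space.mk' g h).fn z = g z := indicator_of_mem hz _

instance : Norm F1Space := ⟨fun g => normF1 g.fn⟩

lemma F1Space.norm_def (g : F1Space) : ‖g‖ = normF1 g.fn := rfl

lemma normF1_smul_le {g : ℂ → ℂ} (h : ∃ μ, RepF1 g μ) (c : ℂ) :
    normF1 (fun z => c * g z) ≤ ‖c‖ * normF1 g := by
  apply le_of_forall_pos_le_add
  intro ε hε
  obtain ⟨μ, h1, h2⟩ := exists_near h (ε := ε / (‖c‖ + 1)) (by positivity)
  obtain ⟨σ, h3, h4⟩ := h1.smul c
  calc _ ≤ _ := normF1_le h4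
    _ = ‖c‖ * μ.norm := h3
    _ ≤ ‖c‖ * (normF1 g + ε / (‖c‖ + 1)) := by gcongr
    _ = ‖c‖ * normF1 g + (‖c‖ / (‖c‖ + 1)) * ε := by ring
    _ ≤ ‖c‖ * normF1 g + 1 * ε := by
      gcongr
      rw [div_le_one (by positivity)]; linarith
    _ = _ := by ring

lemma F1Space.core : NormedSpace.Core ℂ F1Space where
  norm_nonneg x := normF1_nonneg _
  norm_smul c x := by
    apply le_antisymm
    · exact normF1_smul_le x.rep c
    · by_cases hc : c = 0
      · subst hc
        rw [norm_zero, zero_mul]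
        exact normF1_nonneg _
      · have := normF1_smul_le (c • x).rep c⁻¹
        have e : (fun z => c⁻¹ * (c • x).fn z) = x.fn := by
          funext z; rw [F1Space.fn_smul]; field_simp
        rw [e] at this
        rw [F1Space.norm_def, F1Space.norm_def]
        calc ‖c‖ * normF1 x.fn ≤ ‖c‖ * (‖c⁻¹‖ * normF1 (c • x).fn) := by gcongr
          _ = _ := by
            have : ‖c‖ ≠ 0 := by simpa using hc
            rw [norm_inv]; field_simp
  norm_triangle x y := by
    apply le_of_forall_pos_le_add
    intro ε hε
    obtain ⟨μ, h1, h2⟩ := exists_near x.rep (half_pos hε)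
    obtain ⟨μ', h1', h2'⟩ := exists_near y.rep (half_pos hε)
    obtain ⟨σ, h3, h4⟩ := h1.add h1'
    have : normF1 (x + y).fn ≤ σ.norm := normF1_le h4
    rw [F1Space.norm_def, F1Space.norm_def, F1Space.norm_def]
    linarith
  norm_eq_zero_iff x := by
    constructor
    · intro h
      apply F1Space.ext'
      intro z hz
      have := norm_le_normF1 x.rep hz
      rw [F1Space.norm_def] at h
      rw [h, mul_zero] at this
      rw [F1Space.fn_zero]
      simpa using this
    · rintro rfl
      refine le_antisymm ?_ (normF1_nonneg _)
      refine (normF1_le (μ := ⟨0, inferInstance, fun _ => 1, measurable_const, by simp⟩)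
        (fun z hz => ?_)).trans ?_
      · simp [CircleMeasure.integral, F1Space.fn_zero]
      · simp [CircleMeasure.norm]

instance : NormedAddCommGroup F1Space := NormedAddCommGroup.ofCore F1Space.core
instance : NormedSpace ℂ F1Space := NormedSpace.ofCore F1Space.core

lemma F1Space.norm_eq (g : F1Space) : ‖g‖ = normF1 g.fn := rfl

lemma F1Space.norm_le_of_rep (g : F1Space) {μ : CircleMeasure} (h : RepF1 g.fn μ) :
    ‖g‖ ≤ μ.norm := normF1_le h

lemma F1Space.tendsto_eval {α : Type} {l : Filter α} {u : α → F1Space} {x : F1Space}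
    (h : Tendsto u l (𝓝 x)) {z : ℂ} (hz : z ∈ ball (0:ℂ) 1) :
    Tendsto (fun n => (u n).fn z) l (𝓝 (x.fn z)) := by
  rw [tendsto_iff_norm_sub_tendsto_zero] at h ⊢
  have h2 := h.const_mul ((1 - ‖z‖)⁻¹)
  rw [mul_zero] at h2
  refine squeeze_zero (fun _ => norm_nonneg _) (fun n => ?_) h2
  exact norm_le_normF1 (u n - x).rep hz

lemma F1Space.fn_sum (u : ℕ → F1Space) (s : Finset ℕ) (z : ℂ) :
    (∑ i ∈ s, u i).fn z = ∑ i ∈ s, (u i).fn z := by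
  classical
  induction s using Finset.induction_on with
  | empty => simp [F1Space.fn_zero]
  | insert a s ha ih => rw [Finset.sum_insert ha, Finset.sum_insert ha, F1Space.fn_add, ih]

lemma F1Space.tail_bound (u : ℕ → F1Space) (μ : ℕ → CircleMeasure)
    (h1 : ∀ n, RepF1 (u n).fn (μ n)) (hs : Summable fun n => (μ n).norm) (x : F1Space)
    (hsum : ∀ z ∈ ball (0:ℂ) 1, HasSum (fun n => (u n).fn z) (x.fn z)) (n : ℕ) :
    ‖x - ∑ i ∈ Finset.range n, u i‖ ≤ ∑' k, (μ (k + n)).norm := by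
  have hs' : Summable fun k => (μ (k + n)).norm :=
    (summable_nat_add_iff (f := fun k => (μ k).norm) n).2 hs
  obtain ⟨σ', h3, G', hG', hsum'⟩ := RepF1.sum (fun k => (u (k + n)).fn) (fun k => μ (k + n))
    (fun k => h1 (k + n)) hs'
  have hr : RepF1 (x - ∑ i ∈ Finset.range n, u i).fn σ' := by
    refine hG'.congr fun z hz => ?_
    have e : (x - ∑ i ∈ Finset.range n, u i).fn z
        = x.fn z - ∑ i ∈ Finset.range n, (u i).fn z := by
      rw [← F1Space.fn_sum]; exact F1Space.fn_sub _ _ _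
    rw [e]
    have h := (hasSum_nat_add_iff' (f := fun k => (u k).fn z) n).2 (hsum z hz)
    exact h.unique (hsum' z hz)
  exact (F1Space.norm_le_of_rep _ hr).trans h3

lemma F1Space.complete_aux2 (u : ℕ → F1Space) (μ : ℕ → CircleMeasure)
    (h1 : ∀ n, RepF1 (u n).fn (μ n)) (hs : Summable fun n => (μ n).norm) :
    ∃ a, Tendsto (fun n => ∑ i ∈ Finset.range n, u i) atTop (𝓝 a) := by
  obtain ⟨σ, -, G, hG, hsum⟩ := RepF1.sum (fun n => (u n).fn) μ h1 hs
  refine ⟨F1Space.mk' G ⟨σ, hG⟩, ?_⟩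
  rw [tendsto_iff_norm_sub_tendsto_zero]
  refine squeeze_zero (fun _ => norm_nonneg _) (fun n => ?_)
    (tendsto_sum_nat_add (fun n => (μ n).norm))
  rw [norm_sub_rev]
  refine F1Space.tail_bound u μ h1 hs _ (fun z hz => ?_) n
  rw [F1Space.fn_mk' _ _ hz]
  exact hsum z hz

lemma F1Space.complete_aux (u : ℕ → F1Space) (hu : Summable fun n => ‖u n‖) :
    ∃ a, Tendsto (fun n => ∑ i ∈ Finset.range n, u i) atTop (𝓝 a) := by
  have := fun n : ℕ => exists_near (u n).rep (ε := (1/2:ℝ)^n) (by positivity)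
  choose μ h1 h2 using this
  have hs2 : Summable fun n => normF1 (u n).fn + (1/2:ℝ)^n :=
    Summable.add (hu.congr fun n => F1Space.norm_eq _) summable_geometric_two
  have hs : Summable fun n => (μ n).norm :=
    Summable.of_nonneg_of_le (fun n => (μ n).norm_nonneg) (fun n => (h2 n).le) hs2
  exact F1Space.complete_aux2 u μ h1 hs

instance : CompleteSpace F1Space :=
  NormedAddCommGroup.completeSpace_of_summable_imp_tendsto F1Space.complete_aux

lemma RepF1.hasDerivAt {g : ℂ → ℂ} {μ : CircleMeasure} (h : RepF1 g μ) {z : ℂ}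
    (hz : z ∈ ball (0:ℂ) 1) :
    Integrable (fun ζ : Metric.sphere (0:ℂ) 1 => (starRingEnd ℂ) (ζ:ℂ) /
      (1 - (starRingEnd ℂ) (ζ:ℂ) * z) ^ 2 * μ.w ζ) μ.ν ∧
    HasDerivAt g (∫ ζ : Metric.sphere (0:ℂ) 1, (starRingEnd ℂ) (ζ:ℂ) /
      (1 - (starRingEnd ℂ) (ζ:ℂ) * z) ^ 2 * μ.w ζ ∂μ.ν) z := by
  have hz' : ‖z‖ < 1 := by simpa using hz
  have hcm : Measurable (starRingEnd ℂ) := Complex.continuous_conj.measurable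
  have hwm := μ.w_meas
  obtain ⟨R, hR1, hR2⟩ := exists_between hz'
  have hball : ball (0:ℂ) R ∈ 𝓝 z := isOpen_ball.mem_nhds (by simpa using hR1)
  have key := hasDerivAt_integral_of_dominated_loc_of_deriv_le (μ := μ.ν) (𝕜 := ℂ)
    (F := fun z (ζ : Metric.sphere (0:ℂ) 1) => (1 - (starRingEnd ℂ) (ζ:ℂ) * z)⁻¹ * μ.w ζ)
    (F' := fun z (ζ : Metric.sphere (0:ℂ) 1) => (starRingEnd ℂ) (ζ:ℂ) /
      (1 - (starRingEnd ℂ) (ζ:ℂ) * z) ^ 2 * μ.w ζ) (x₀ := z) (bound := fun _ => 1 / (1 - R) ^ 2)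
    hball ?_ ?_ ?_ ?_ ?_ ?_
  · refine ⟨key.1, key.2.congr_of_eventuallyEq ?_⟩
    filter_upwards [isOpen_ball.mem_nhds hz] with y hy
    exact h y hy
  · refine Eventually.of_forall fun y => ?_
    exact ((kernel_meas y).mul hwm).aestronglyMeasurable
  · refine (integrable_const ((1 - ‖z‖)⁻¹)).mono'
      ((kernel_meas z).mul hwm).aestronglyMeasurable (Eventually.of_forall fun x => ?_)
    rw [norm_mul, μ.w_norm, mul_one]
    exact kernel_bdd z hz x
  · apply Measurable.aestronglyMeasurable
    fun_prop
  · refine Eventually.of_forall fun x y hy => ?_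
    have hy' : ‖y‖ < R := by simpa using hy
    have hx : ‖(x:ℂ)‖ = 1 := by simpa using x.2
    have := kernel_low y x
    rw [norm_mul, μ.w_norm, mul_one, norm_div, norm_pow, RCLike.norm_conj, hx]
    gcongr
    linarith
  · exact integrable_const _
  · refine Eventually.of_forall fun x y hy => ?_
    have hy' : ‖y‖ < R := by simpa using hy
    have := kernel_low y x
    have hne : 1 - (starRingEnd ℂ) (x:ℂ) * y ≠ 0 := by
      rw [← norm_pos_iff]; linarith
    have h1 : HasDerivAt (fun y => 1 - (starRingEnd ℂ) (x:ℂ) * y) (-(starRingEnd ℂ) (x:ℂ)) y := by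
      simpa using ((hasDerivAt_id y).const_mul ((starRingEnd ℂ) (x:ℂ))).const_sub 1
    simpa using (h1.inv hne).mul_const (μ.w x)

lemma RepF1.memF1 {g : ℂ → ℂ} {μ : CircleMeasure} (h : RepF1 g μ) : MemF1 g :=
  ⟨fun _ hz => (h.hasDerivAt hz).2.differentiableAt.differentiableWithinAt, μ, h⟩

lemma bddAbove_M1 {f : ℂ → ℂ} (hf : MemM1 f) :
    BddAbove {c | ∃ g, MemF1 g ∧ normF1 g ≤ 1 ∧ normF1 (fun z => f z * g z) = c} := by
  have hmem : ∀ g : F1Space, ∃ μ, RepF1 (fun z => f z * g.fn z) μ := fun g =>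
    (hf.2 g.fn (g.rep.choose_spec.memF1)).2
  let T : F1Space →ₗ[ℂ] F1Space :=
    { toFun := fun g => F1Space.mk' (fun z => f z * g.fn z) (hmem g)
      map_add' := fun a b => F1Space.ext' fun z hz => by
        rw [F1Space.fn_add, F1Space.fn_mk' _ _ hz, F1Space.fn_mk' _ _ hz, F1Space.fn_mk' _ _ hz,
          F1Space.fn_add, mul_add]
      map_smul' := fun c b => F1Space.ext' fun z hz => by
        rw [RingHom.id_apply, F1Space.fn_smul, F1Space.fn_mk' _ _ hz, F1Space.fn_mk' _ _ hz,
          F1Space.fn_smul]; ring }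
  have hT : ∀ g z, z ∈ ball (0:ℂ) 1 → (T g).fn z = f z * g.fn z := fun g z hz =>
    F1Space.fn_mk' _ (hmem g) hz
  have hc : Continuous T := by
    apply LinearMap.continuous_of_seq_closed_graph
    intro u x y hu hTu
    apply F1Space.ext'
    intro z hz
    have h1 := F1Space.tendsto_eval hTu hz
    have h2 := (F1Space.tendsto_eval hu hz).const_mul (f z)
    rw [hT x z hz]
    refine tendsto_nhds_unique h1 (h2.congr fun n => ?_)
    exact (hT _ z hz).symm
  let L : F1Space →L[ℂ] F1Space := ⟨T, hc⟩
  refine ⟨‖L‖, ?_⟩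
  rintro _ ⟨g, hg, hg1, rfl⟩
  have h1 := L.le_opNorm (F1Space.mk' g hg.2)
  have h2 : ‖L (F1Space.mk' g hg.2)‖ = normF1 (fun z => f z * g z) :=
    normF1_congr fun z hz => by
      rw [show L (F1Space.mk' g hg.2) = T (F1Space.mk' g hg.2) from rfl, hT _ z hz,
        F1Space.fn_mk' _ _ hz]
  have h3 : ‖F1Space.mk' g hg.2‖ = normF1 g := normF1_congr fun z hz => F1Space.fn_mk' _ _ hz
  rw [h2, h3] at h1
  refine h1.trans ?_
  exact mul_le_of_le_one_right (norm_nonneg _) hg1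

lemma real_int {b : ℝ} (hb : 0 < b) (hb1 : b ≤ 1) :
    ∫ r in (0:ℝ)..1, 2 * b / ((1 - r) ^ 2 + 4 * b ^ 2 * r) ≤ Real.pi / 2 := by
  have hpos : ∀ r ∈ Set.uIcc (0:ℝ) 1, 0 < (1 - r) ^ 2 + 4 * b ^ 2 * r := by
    intro r hr
    rw [Set.uIcc_of_le zero_le_one] at hr
    rcases hr.1.eq_or_lt with h | h
    · subst h; norm_num
    · positivity
  have hii : IntervalIntegrable (fun r => 2 * b / ((1 - r) ^ 2 + 4 * b ^ 2 * r)) volume 0 1 := by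
    apply ContinuousOn.intervalIntegrable
    exact ContinuousOn.div (by fun_prop) (by fun_prop) fun r hr => (hpos r hr).ne'
  rcases hb1.eq_or_lt with h | h
  · subst h
    rw [intervalIntegral.integral_eq_sub_of_hasDerivAt (f := fun r => -2 / (1 + r)) _ hii]
    · have := Real.pi_gt_three
      norm_num; linarith
    · intro r hr
      have hr' := hr
      rw [Set.uIcc_of_le zero_le_one] at hr'
      have h0 : 1 + r ≠ 0 := by linarith [hr'.1]
      have := (((hasDerivAt_id r).const_add 1).inv h0).const_mul (-2)
      simp only [id] at this
      refine (this.congr_deriv ?_)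
      have := (hpos r hr).ne'
      rw [show (1 - r) ^ 2 + 4 * 1 ^ 2 * r = (1 + r) ^ 2 by ring]
      field_simp
      
  · set s := Real.sqrt (1 - b ^ 2) with hs
    have h1 : 0 < 1 - b ^ 2 := by nlinarith
    have hs0 : 0 < s := Real.sqrt_pos.2 h1
    have hs2 : s ^ 2 = 1 - b ^ 2 := Real.sq_sqrt h1.le
    rw [intervalIntegral.integral_eq_sub_of_hasDerivAt
      (f := fun r => -(1 / s) * Real.arctan (s / b * ((1 - r) / (1 + r)))) _ hii]
    · have e : Real.sin (Real.arctan (s / b)) = s := by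
        rw [Real.sin_arctan]
        have : Real.sqrt (1 + (s / b) ^ 2) = 1 / b := by
          rw [Real.sqrt_eq_iff_mul_self_eq (by positivity) (by positivity)]
          field_simp
          linarith
        rw [this]; field_simp
      have h2 := Real.mul_le_sin (x := Real.arctan (s / b))
        (Real.arctan_nonneg.2 (by positivity)) (Real.arctan_lt_pi_div_two _).le
      rw [e] at h2
      norm_num
      have hpi := Real.pi_pos
      rw [inv_mul_le_iff₀ hs0]
      calc Real.arctan (s / b) = (Real.pi / 2) * (2 / Real.pi * Real.arctan (s / b)) := by
            field_simp
        _ ≤ (Real.pi / 2) * s := by gcongr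
        _ = _ := by ring
    · intro r hr
      have hr' := hr
      rw [Set.uIcc_of_le zero_le_one] at hr'
      have h0 : 1 + r ≠ 0 := by linarith [hr'.1]
      have h3 := (((hasDerivAt_id r).const_sub 1).div ((hasDerivAt_id r).const_add 1) h0).const_mul
        (s / b)
      have h4 := (h3.arctan).const_mul (-(1 / s))
      simp only [id, Pi.div_apply] at h4
      refine h4.congr_deriv ?_
      have hp := (hpos r hr).ne'
      have h5 : 1 + (s / b * ((1 - r) / (1 + r))) ^ 2 =
          ((1 - r) ^ 2 + 4 * b ^ 2 * r) / (b ^ 2 * (1 + r) ^ 2) := by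
        field_simp
        rw [hs2]; ring
      rw [h5]
      field_simp
      ring

lemma norm_sq_id {u : ℂ} (hu : ‖u‖ = 1) (r : ℝ) :
    ‖1 - r * u‖ ^ 2 = (1 - r) ^ 2 + r * ‖1 - u‖ ^ 2 := by
  have h : u.re * u.re + u.im * u.im = 1 := by
    rw [← Complex.normSq_apply, Complex.normSq_eq_norm_sq, hu]; norm_num
  rw [← Complex.normSq_eq_norm_sq, ← Complex.normSq_eq_norm_sq, Complex.normSq_apply,
    Complex.normSq_apply]
  simp
  linear_combination (r ^ 2 - r) * h

lemma lint_kernel {u : ℂ} (hu : ‖u‖ = 1) :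
    ∫⁻ r in Ioc (0:ℝ) 1, ENNReal.ofReal (‖1 - u‖ / ‖1 - r * u‖ ^ 2) ≤
      ENNReal.ofReal (Real.pi / 2) := by
  by_cases h1 : u = 1
  · simp [h1]
  have ha : 0 < ‖1 - u‖ := norm_pos_iff.2 (sub_ne_zero.2 (Ne.symm h1))
  have ha2 : ‖1 - u‖ ≤ 2 := (norm_sub_le _ _).trans (by rw [hu]; norm_num)
  set b := ‖1 - u‖ / 2 with hb
  have e : ∀ r : ℝ, ‖1 - u‖ / ‖1 - r * u‖ ^ 2 = 2 * b / ((1 - r) ^ 2 + 4 * b ^ 2 * r) := by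
    intro r
    rw [norm_sq_id hu, hb]; congr 1 <;> ring
  simp_rw [e]
  have hpos : ∀ r ∈ Set.Icc (0:ℝ) 1, 0 < (1 - r) ^ 2 + 4 * b ^ 2 * r := by
    intro r hr
    rcases hr.1.eq_or_lt with h | h
    · subst h; norm_num
    · positivity
  have hc : ContinuousOn (fun r => 2 * b / ((1 - r) ^ 2 + 4 * b ^ 2 * r)) (Set.Icc (0:ℝ) 1) :=
    ContinuousOn.div (by fun_prop) (by fun_prop) fun r hr => (hpos r hr).ne'
  rw [← ofReal_integral_eq_lintegral_ofReal]
  · apply ENNReal.ofReal_le_ofReal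
    rw [← intervalIntegral.integral_of_le zero_le_one]
    exact real_int (by positivity) (by rw [hb]; linarith)
  · exact (hc.integrableOn_Icc).mono_set Ioc_subset_Icc_self
  · refine (ae_restrict_iff' measurableSet_Ioc).2 (Eventually.of_forall fun r hr => ?_)
    have := hpos r (Ioc_subset_Icc_self hr)
    simp only [Pi.zero_apply]
    positivity

lemma deriv_bound {f : ℂ → ℂ} {ζ : ℂ} (hζ : ‖ζ‖ = 1) {μ : CircleMeasure}
    (h : RepF1 (fun z => f z * (1 - (starRingEnd ℂ) ζ * z)⁻¹) μ) {r : ℝ} (hr : 0 < r)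
    (hr1 : r < 1) :
    ‖deriv f (r * ζ)‖ₑ ≤ ∫⁻ η : Metric.sphere (0:ℂ) 1,
      ENNReal.ofReal (‖1 - (starRingEnd ℂ) (η:ℂ) * ζ‖ /
        ‖1 - r * ((starRingEnd ℂ) (η:ℂ) * ζ)‖ ^ 2) ∂μ.ν := by
  have hn : ‖(r:ℂ) * ζ‖ = r := by simp [hζ, abs_of_pos hr]
  have hz : (r:ℂ) * ζ ∈ ball (0:ℂ) 1 := by rw [mem_ball_zero_iff, hn]; exact hr1
  set z : ℂ := r * ζ with hzdef
  have hne : ∀ (η : Metric.sphere (0:ℂ) 1) (y : ℂ), y ∈ ball (0:ℂ) 1 →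
      1 - (starRingEnd ℂ) (η:ℂ) * y ≠ 0 := by
    intro η y hy
    have := kernel_low y η
    have hy' : ‖y‖ < 1 := by simpa using hy
    rw [← norm_pos_iff]; linarith
  obtain ⟨hI, hD⟩ := h.hasDerivAt hz
  have h1 : HasDerivAt (fun y => 1 - (starRingEnd ℂ) ζ * y) (-(starRingEnd ℂ) ζ) z := by
    simpa using ((hasDerivAt_id z).const_mul ((starRingEnd ℂ) ζ)).const_sub 1
  have h2 := h1.mul hD
  have h3 : HasDerivAt f _ z := h2.congr_of_eventuallyEq (by
    filter_upwards [isOpen_ball.mem_nhds hz] with y hy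
    have := hne ⟨ζ, by simpa using hζ⟩ y hy
    simp only [Pi.mul_apply] at this ⊢
    field_simp)
  have hJ : Integrable (fun η : Metric.sphere (0:ℂ) 1 =>
      (1 - (starRingEnd ℂ) (η:ℂ) * z)⁻¹ * μ.w η) μ.ν := by
    refine (integrable_const ((1 - ‖z‖)⁻¹)).mono'
      ((kernel_meas z).mul μ.w_meas).aestronglyMeasurable (Eventually.of_forall fun x => ?_)
    rw [norm_mul, μ.w_norm, mul_one]
    exact kernel_bdd z hz x
  have h4 : deriv f z = ∫ η : Metric.sphere (0:ℂ) 1,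
      ((starRingEnd ℂ) (η:ℂ) - (starRingEnd ℂ) ζ) /
        (1 - (starRingEnd ℂ) (η:ℂ) * z) ^ 2 * μ.w η ∂μ.ν := by
    have hzz : f z * (1 - (starRingEnd ℂ) ζ * z)⁻¹ = _ := h z hz
    rw [h3.deriv, hzz, CircleMeasure.integral, ← integral_const_mul, ← integral_const_mul,
      ← integral_add (hJ.const_mul _) (hI.const_mul _)]
    congr 1; ext η
    have := hne η z hz
    field_simp
    ring
  rw [h4]
  refine (enorm_integral_le_lintegral_enorm _).trans (lintegral_mono fun η => ?_)
  rw [← ofReal_norm]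
  apply ENNReal.ofReal_le_ofReal
  rw [norm_mul, μ.w_norm, mul_one, norm_div, norm_pow]
  apply le_of_eq
  congr 1
  · have hc : (starRingEnd ℂ) ζ * ζ = 1 := by
      rw [mul_comm, Complex.mul_conj, Complex.normSq_eq_norm_sq, hζ]; norm_num
    have : 1 - (starRingEnd ℂ) (η:ℂ) * ζ = -(((starRingEnd ℂ) (η:ℂ) - (starRingEnd ℂ) ζ) * ζ) := by
      linear_combination -hc
    rw [this, norm_neg, norm_mul, hζ, mul_one]
  · congr 2
    rw [hzdef]; ring

lemma lint_bound {f : ℂ → ℂ} {ζ : ℂ} (hζ : ‖ζ‖ = 1) {μ : CircleMeasure}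
    (h : RepF1 (fun z => f z * (1 - (starRingEnd ℂ) ζ * z)⁻¹) μ) :
    ∫⁻ r in Ioc (0:ℝ) 1, ‖deriv f (r * ζ)‖ₑ ≤ ENNReal.ofReal (Real.pi / 2 * μ.norm) := by
  have hcm : Measurable (starRingEnd ℂ) := Complex.continuous_conj.measurable
  calc _ ≤ ∫⁻ r in Ioc (0:ℝ) 1, ∫⁻ η : Metric.sphere (0:ℂ) 1,
      ENNReal.ofReal (‖1 - (starRingEnd ℂ) (η:ℂ) * ζ‖ /
        ‖1 - r * ((starRingEnd ℂ) (η:ℂ) * ζ)‖ ^ 2) ∂μ.ν := by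
        apply lintegral_mono_ae
        rw [ae_restrict_iff' measurableSet_Ioc]
        have : ∀ᵐ r : ℝ, r ≠ 1 := by simp [ae_iff]
        filter_upwards [this] with r hr1 hr
        exact deriv_bound hζ h hr.1 (lt_of_le_of_ne hr.2 hr1)
    _ = ∫⁻ η : Metric.sphere (0:ℂ) 1, (∫⁻ r in Ioc (0:ℝ) 1,
      ENNReal.ofReal (‖1 - (starRingEnd ℂ) (η:ℂ) * ζ‖ /
        ‖1 - r * ((starRingEnd ℂ) (η:ℂ) * ζ)‖ ^ 2)) ∂μ.ν := by
        apply lintegral_lintegral_swap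
        apply Measurable.aemeasurable
        unfold Function.uncurry
        fun_prop
    _ ≤ ∫⁻ η : Metric.sphere (0:ℂ) 1, ENNReal.ofReal (Real.pi / 2) ∂μ.ν := by
        refine lintegral_mono fun η => lint_kernel ?_
        have hx : ‖(η:ℂ)‖ = 1 := by simpa using η.2
        simp [hx, hζ]
    _ = _ := by
        have := Real.pi_pos
        rw [lintegral_const, ENNReal.ofReal_mul (by positivity), CircleMeasure.norm,
          ENNReal.ofReal_toReal (measure_ne_top _ _)]

/-- **Theorem D(b).** If `f ∈ m₁`, then for every `ζ` on the unit circle,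
`∫_0^1 |f'(rζ)| dr ≤ (π/2) ‖f‖_{m₁} < ∞`. -/
theorem stmt_1 (f : ℂ → ℂ) (hf : MemM1 f) (ζ : ℂ) (hζ : ‖ζ‖ = 1) :
    IntervalIntegrable (fun r : ℝ => ‖deriv f ((r : ℂ) * ζ)‖) MeasureTheory.volume 0 1 ∧
    ∫ r in (0:ℝ)..1, ‖deriv f ((r : ℂ) * ζ)‖ ≤ (Real.pi / 2) * normM1 f := by
  have hk : RepF1 (fun z => (1 - (starRingEnd ℂ) ζ * z)⁻¹)
      ⟨Measure.dirac ⟨ζ, by simpa using hζ⟩, inferInstance, fun _ => 1, measurable_const,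
        by simp⟩ := by
    intro z hz
    simp [CircleMeasure.integral]
  have hkm := hk.memF1
  have hk1 : normF1 (fun z => (1 - (starRingEnd ℂ) ζ * z)⁻¹) ≤ 1 :=
    (normF1_le hk).trans (by simp [CircleMeasure.norm])
  have hfk := (hf.2 _ hkm).2
  have hle : normF1 (fun z => f z * (1 - (starRingEnd ℂ) ζ * z)⁻¹) ≤ normM1 f :=
    le_csSup (bddAbove_M1 hf) ⟨_, hkm, hk1, rfl⟩
  have hpi := Real.pi_pos
  have hmeas : Measurable fun r : ℝ => deriv f (r * ζ) :=
    (measurable_deriv f).comp (by fun_prop)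
  have hint : IntegrableOn (fun r : ℝ => ‖deriv f ((r : ℂ) * ζ)‖) (Ioc 0 1) volume := by
    obtain ⟨μ, hμ⟩ := hfk
    refine Integrable.norm ⟨hmeas.aestronglyMeasurable, ?_⟩
    exact (lint_bound hζ hμ).trans_lt ENNReal.ofReal_lt_top
  refine ⟨(intervalIntegrable_iff_integrableOn_Ioc_of_le zero_le_one).2 hint, ?_⟩
  have hb : ∀ ε > 0, ∫ r in (0:ℝ)..1, ‖deriv f ((r : ℂ) * ζ)‖ ≤
      (Real.pi / 2) * (normM1 f + ε) := by
    intro ε hε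
    obtain ⟨μ, hμ, hμ2⟩ := exists_near hfk hε
    rw [intervalIntegral.integral_of_le zero_le_one,
      integral_norm_eq_lintegral_enorm hmeas.aestronglyMeasurable]
    have := μ.norm_nonneg
    refine (ENNReal.toReal_le_of_le_ofReal (by positivity) (lint_bound hζ hμ)).trans ?_
    gcongr
    linarith
  apply le_of_forall_pos_le_add
  intro ε hε
  refine (hb (ε / (Real.pi / 2)) (by positivity)).trans (le_of_eq ?_)
  field_simp
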